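/- Second recurrence relation (7-term recurrence): for every real q with 0 < q < 1, every positive integer N, all nonzero real numbers θ, φ, all integers n₁, n₂ ≥ 0 with n₁+n₂ ≤ N-1, and all integers x₁, x₂ ≥ 0 with x₁+x₂ ≤ N, writing K_{m₁,m₂} := K_{m₁,m₂}(x₁,x₂;θ,φ;N) (with K := 0 if a degree index is negative), one has q^{-x₁} K_{n₁,n₂} = q^{-2n₁}[q^{n₁}(1+θ²-q^{-n₁-1}(1+q)θ²) + q^{-n₂-1}θ²(1+φ²+q^{n₁-N-1}φ²-q^{-n₂-1}(1+q)φ²)] K_{n₁,n₂} + q^{-(n₂+2)} φ² (1-q^{n₁})(1-q^{n₁+n₂-N-1})(1-θ² q^{-n₁}) K_{n₁-1,n₂} + q^{-2(n₂+1)} φ² (1-q^{n₁})(1-θ² q^{-n₁}) K_{n₁-1,n₂+1} + q^{-(2n₁+2)} θ² (1-q^{n₂})(1-q^{n₁+n₂-N-1})(1-φ² q^{-n₂}) K_{n₁,n₂-1} - q^{-(3n₂+2n₁+2)} θ²φ² K_{n₁,n₂+1} - q^{-(3n₁+n₂+1)} θ² K_{n₁+1,n₂} + θ²φ^{-2} q^{n₂-3n₁-2}(1-q^{n₂})(1-φ²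 q^{-n₂}) K_{n₁+1,n₂-1}. -/

import Mathlib

open Finset

/-- The q-Pochhammer symbol `(a;q)_n = ∏_{k=0}^{n-1} (1 - a q^k)`. -/
noncomputable def qPoch (q a : ℝ) (n : ℕ) : ℝ := ∏ k ∈ Finset.range n, (1 - a * q ^ k)

/-- The quantum q-Krawtchouk polynomial `k_n(x;p,N;q)`, defined for all integers `x, N`. -/
noncomputable def qKraw (q : ℝ) (n : ℕ) (x N : ℤ) (p : ℝ) : ℝ :=
  (-1 : ℝ) ^ n * q ^ (n * (n - 1) / 2) *
    ∑ k ∈ Finset.range (n + 1),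
      qPoch q (q ^ (-(n : ℤ))) k * qPoch q (q ^ (-x)) k *
        qPoch q (q ^ ((k : ℤ) - N)) (n - k) / qPoch q q k * (p * q ^ (n + 1)) ^ k

/-- The bivariate quantum q-Krawtchouk polynomial of Gasper and Rahman,
`K_{n₁,n₂}(x₁,x₂;θ,φ;N) = k_{n₁}(x₁;θ^{-2},x₁+x₂;q) k_{n₂}(x₁+x₂-n₁;φ^{-2},N-n₁;q)`,
with the convention that it vanishes when a degree index is negative. -/
noncomputable def Kq (q : ℝ) (n₁ n₂ x₁ x₂ : ℤ) (θ φ : ℝ) (N : ℤ) : ℝ :=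
  if 0 ≤ n₁ ∧ 0 ≤ n₂ then
    qKraw q n₁.toNat x₁ (x₁ + x₂) (θ ^ 2)⁻¹ *
      qKraw q n₂.toNat (x₁ + x₂ - n₁) (N - n₁) (φ ^ 2)⁻¹
  else 0

/-- The q-trinomial coefficient `[N; x₁, x₂]_q`. -/
noncomputable def qTrinom (q : ℝ) (N x₁ x₂ : ℕ) : ℝ :=
  qPoch q q N / (qPoch q q x₁ * qPoch q q x₂ * qPoch q q (N - x₁ - x₂))

/-- The orthogonality weight `Δ^{(N)}_{x₁,x₂}(θ,φ)`. -/
noncomputable def Δw (q : ℝ) (N x₁ x₂ : ℕ) (θ φ : ℝ) : ℝ :=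
  (-1 : ℝ) ^ (N - x₁) * (θ ^ 2 * q⁻¹) ^ (x₁ + x₂) * q ^ (x₁ * (x₁ - 1) / 2) *
    qTrinom q N x₁ x₂ * qPoch q ((θ ^ 2)⁻¹ * q) x₂ * qPoch q ((φ ^ 2)⁻¹ * q) (N - x₁ - x₂) *
    φ ^ (2 * N) * q ^ (-((N : ℤ) * (N + 1) / 2))

/-- The normalization constant `H^{(N)}_{n₁,n₂}(θ,φ)`. -/
noncomputable def Hn (q : ℝ) (N n₁ n₂ : ℕ) (θ φ : ℝ) : ℝ :=
  (-1 : ℝ) ^ (n₁ + n₂) * qPoch q (q * (θ ^ 2)⁻¹) n₁ * qPoch q (q * (φ ^ 2)⁻¹) n₂ *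
    φ ^ (2 * n₁) * (qPoch q q N / qPoch q q (N - n₁ - n₂)) ^ 2 * (qTrinom q N n₁ n₂)⁻¹ *
    q ^ (3 * ((n₁ : ℤ) * (n₁ - 1)) / 2 + 3 * ((n₂ : ℤ) * (n₂ - 1)) / 2 +
          (n₁ : ℤ) * n₂ - (N : ℤ) * (n₁ + n₂) - 2 * n₁ - n₂)

/-- The dual weight `Δ̃^{(N)}_{n₁,n₂}(θ,φ)`. -/
noncomputable def Δdual (q : ℝ) (N n₁ n₂ : ℕ) (θ φ : ℝ) : ℝ :=
  (-1 : ℝ) ^ (n₁ + n₂) * q ^ (-((n₁ : ℤ) * (n₁ - 1)) - (n₂ : ℤ) * (n₂ - 1)) *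
    φ ^ (-(2 * (n₁ : ℤ))) * (qPoch q q (N - n₁ - n₂) / qPoch q q N) ^ 2 * qTrinom q N n₁ n₂ *
    q ^ ((N : ℤ) * (n₁ + n₂) + 2 * n₁ + n₂ - (n₁ : ℤ) * n₂ -
          (n₁ : ℤ) * (n₁ - 1) / 2 - (n₂ : ℤ) * (n₂ - 1) / 2) /
    (qPoch q (q * (θ ^ 2)⁻¹) n₁ * qPoch q (q * (φ ^ 2)⁻¹) n₂)

/-- The quantum q-Krawtchouk polynomial as a function of the real variables `X = q^{-x}` and
`Z = q^{-N}`. -/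
noncomputable def qKrawReal (q p : ℝ) (n : ℕ) (X Z : ℝ) : ℝ :=
  (-1 : ℝ) ^ n * q ^ (n * (n - 1) / 2) *
    ∑ k ∈ range (n + 1),
      qPoch q (q ^ n)⁻¹ k * qPoch q X k * qPoch q (q ^ k * Z) (n - k) / qPoch q q k *
        (p * q ^ (n + 1)) ^ k

lemma qPoch_zero (q a : ℝ) : qPoch q a 0 = 1 := by simp [qPoch]

lemma qPoch_succ (q a : ℝ) (n : ℕ) : qPoch q a (n + 1) = qPoch q a n * (1 - a * q ^ n) := by
  simp [qPoch, prod_range_succ]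

lemma qPoch_succ' (q a : ℝ) (n : ℕ) : qPoch q a (n + 1) = (1 - a) * qPoch q (q * a) n := by
  simp only [qPoch, prod_range_succ', pow_zero, mul_one, mul_comm (1 - a)]
  congr 1
  exact prod_congr rfl fun k _ => by ring

lemma qPoch_self_ne_zero {q : ℝ} (hq0 : 0 < q) (hq1 : q < 1) (n : ℕ) : qPoch q q n ≠ 0 := by
  refine prod_ne_zero_iff.mpr fun k _ => ?_
  have := pow_lt_one₀ hq0.le hq1 k.succ_ne_zero
  rw [pow_succ'] at this
  linarith

lemma qPoch_inv_pow_self {q : ℝ} (hq0 : 0 < q) (n : ℕ) : qPoch q (q ^ n)⁻¹ (n + 1) = 0 := by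
  rw [qPoch_succ, inv_mul_cancel₀ (pow_pos hq0 n).ne', sub_self, mul_zero]

lemma pow_triangle_succ (q : ℝ) (n : ℕ) :
    q ^ ((n + 1) * (n + 1 - 1) / 2) = q ^ (n * (n - 1) / 2) * q ^ n := by
  rw [← pow_add, ← Nat.choose_two_right, ← Nat.choose_two_right, Nat.choose_succ_succ' n 1,
    Nat.choose_one_right, add_comm]

lemma qKraw_eq_qKrawReal {q : ℝ} (hq0 : 0 < q) (n : ℕ) (x N : ℤ) (p : ℝ) :
    qKraw q n x N p = qKrawReal q p n (q ^ (-x)) (q ^ (-N)) := by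
  unfold qKraw qKrawReal
  simp only [sub_eq_add_neg, zpow_add₀ hq0.ne', zpow_neg, zpow_natCast]

/-- The raising relation of the quantum q-Krawtchouk polynomials: `k_n(x - 1; N - 1)` is a
combination of `k_n(x; N)` and `k_{n+1}(x; N)`. -/
lemma qKrawReal_raise {q : ℝ} (hq0 : 0 < q) (hq1 : q < 1) (p : ℝ) (n : ℕ) (X Z : ℝ) :
    q ^ n * (1 - q ^ n * Z) * qKrawReal q p n X Z + qKrawReal q p (n + 1) X Z =
      p * q ^ (2 * n + 1) * (1 - X) * qKrawReal q p n (q * X) (q * Z) := by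
  have hq := hq0.ne'
  unfold qKrawReal
  have h1 : (1 - q ^ n * Z) * ∑ k ∈ range (n + 1),
      qPoch q (q ^ n)⁻¹ k * qPoch q X k * qPoch q (q ^ k * Z) (n - k) / qPoch q q k *
        (p * q ^ (n + 1)) ^ k = ∑ k ∈ range (n + 1 + 1),
      qPoch q (q ^ n)⁻¹ k * qPoch q X k * qPoch q (q ^ k * Z) (n + 1 - k) / qPoch q q k *
        (p * q ^ (n + 1)) ^ k := by
    rw [sum_range_succ _ (n + 1), qPoch_inv_pow_self hq0, mul_sum]
    simp only [zero_mul, zero_div, add_zero]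
    refine sum_congr rfl fun k hk => ?_
    obtain ⟨m, rfl⟩ := Nat.exists_eq_add_of_le (Nat.lt_succ_iff.mp (mem_range.mp hk))
    rw [show k + m + 1 - k = m + 1 by lia, show k + m - k = m by lia, qPoch_succ _ _ m]
    ring
  rw [pow_triangle_succ]
  suffices h : (∑ k ∈ range (n + 1 + 1),
      qPoch q (q ^ n)⁻¹ k * qPoch q X k * qPoch q (q ^ k * Z) (n + 1 - k) / qPoch q q k *
        (p * q ^ (n + 1)) ^ k) - (∑ k ∈ range (n + 1 + 1),
      qPoch q (q ^ (n + 1))⁻¹ k * qPoch q X k * qPoch q (q ^ k * Z) (n + 1 - k) / qPoch q q k *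
        (p * q ^ (n + 1 + 1)) ^ k) = p * q ^ (n + 1) * (1 - X) * ∑ k ∈ range (n + 1),
      qPoch q (q ^ n)⁻¹ k * qPoch q (q * X) k * qPoch q (q ^ k * (q * Z)) (n - k) / qPoch q q k *
        (p * q ^ (n + 1)) ^ k by
    linear_combination (-1 : ℝ) ^ n * q ^ (n * (n - 1) / 2) * q ^ n * (h + h1)
  rw [← sum_sub_distrib, sum_range_succ', mul_sum]
  simp only [qPoch_zero, pow_zero, sub_self, add_zero]
  refine sum_congr rfl fun k _ => ?_
  have hk := qPoch_self_ne_zero hq0 hq1 (k + 1)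
  rw [qPoch_succ] at hk
  have hk1 := left_ne_zero_of_mul hk
  have hk2 := right_ne_zero_of_mul hk
  have e : q * (q ^ (n + 1))⁻¹ = (q ^ n)⁻¹ := by rw [pow_succ']; field_simp
  have e2 : q ^ (k + 1) * Z = q ^ k * (q * Z) := by ring
  rw [qPoch_succ' q (q ^ (n + 1))⁻¹, e, qPoch_succ' q X, qPoch_succ q (q ^ n)⁻¹, qPoch_succ q q,
    Nat.add_sub_add_right, e2, show p * q ^ (n + 1 + 1) = p * q ^ (n + 1) * q by ring,
    mul_pow _ q, pow_succ (p * q ^ (n + 1)), pow_succ q k]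
  generalize qPoch q (q ^ k * (q * Z)) (n - k) = B, (p * q ^ (n + 1)) ^ k = T
  generalize q ^ k = K at *
  rw [mul_comm q K] at hk2 ⊢
  field_simp
  ring

/-- The expansion of `k_n(x; N)` in the polynomials `k_m(x - 1; N - 1)`. -/
lemma qKrawReal_expand {q : ℝ} (hq0 : 0 < q) (hq1 : q < 1) (p : ℝ) (n : ℕ) (X Z : ℝ) :
    qKrawReal q p n X Z = (q ^ n)⁻¹ * qKrawReal q p n (q * X) (q * Z) +
      (1 - q ^ n) * (1 - p * q ^ n) * q⁻¹ * qKrawReal q p (n - 1) (q * X) (q * Z) := by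
  have hq := hq0.ne'
  rcases n with _ | n
  · simp [qKrawReal, qPoch_zero]
  rw [Nat.add_sub_cancel]
  have e1 : ∀ k, qPoch q X k = (q ^ k)⁻¹ * qPoch q (q * X) k +
      (1 - (q ^ k)⁻¹) * qPoch q (q * X) (k - 1) := by
    rintro (_ | k)
    · simp [qPoch_zero]
    · rw [qPoch_succ', qPoch_succ, Nat.add_sub_cancel]
      field_simp
      ring
  have split : ∑ k ∈ range (n + 1 + 1),
      qPoch q (q ^ (n + 1))⁻¹ k * qPoch q X k * qPoch q (q ^ k * Z) (n + 1 - k) / qPoch q q k *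
        (p * q ^ (n + 1 + 1)) ^ k =
      ∑ k ∈ range (n + 1 + 1), (q ^ k)⁻¹ * (qPoch q (q ^ (n + 1))⁻¹ k * qPoch q (q * X) k *
        qPoch q (q ^ k * Z) (n + 1 - k) / qPoch q q k * (p * q ^ (n + 1 + 1)) ^ k) +
      ∑ k ∈ range (n + 1), (1 - (q ^ (k + 1))⁻¹) * (qPoch q (q ^ (n + 1))⁻¹ (k + 1) *
        qPoch q (q * X) k * qPoch q (q ^ (k + 1) * Z) (n - k) / qPoch q q (k + 1) *
        (p * q ^ (n + 1 + 1)) ^ (k + 1)) := by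
    have shift := sum_range_succ' (fun k => (1 - (q ^ k)⁻¹) * (qPoch q (q ^ (n + 1))⁻¹ k *
        qPoch q (q * X) (k - 1) * qPoch q (q ^ k * Z) (n + 1 - k) / qPoch q q k *
        (p * q ^ (n + 1 + 1)) ^ k)) (n + 1)
    simp only [Nat.add_sub_cancel, Nat.add_sub_add_right, pow_zero, inv_one, sub_self, zero_mul,
      add_zero] at shift
    rw [← shift, ← sum_add_distrib]
    refine sum_congr rfl fun k _ => ?_
    rw [e1 k]
    ring
  unfold qKrawReal
  rw [pow_triangle_succ, split, sum_range_succ, sum_range_succ _ (n + 1), Nat.sub_self, qPoch_zero,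
    qPoch_zero]
  suffices h : ∑ k ∈ range (n + 1), (q ^ k)⁻¹ * (qPoch q (q ^ (n + 1))⁻¹ k *
        qPoch q (q * X) k *
        qPoch q (q ^ k * Z) (n + 1 - k) / qPoch q q k * (p * q ^ (n + 1 + 1)) ^ k) +
      ∑ k ∈ range (n + 1), (1 - (q ^ (k + 1))⁻¹) * (qPoch q (q ^ (n + 1))⁻¹ (k + 1) *
        qPoch q (q * X) k * qPoch q (q ^ (k + 1) * Z) (n - k) / qPoch q q (k + 1) *
        (p * q ^ (n + 1 + 1)) ^ (k + 1)) =
      (q ^ (n + 1))⁻¹ * ∑ k ∈ range (n + 1), qPoch q (q ^ (n + 1))⁻¹ k * qPoch q (q * X) k *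
        qPoch q (q ^ k * (q * Z)) (n + 1 - k) / qPoch q q k * (p * q ^ (n + 1 + 1)) ^ k +
      -(q ^ n)⁻¹ * (1 - q ^ (n + 1)) * (1 - p * q ^ (n + 1)) * q⁻¹ * ∑ k ∈ range (n + 1),
        qPoch q (q ^ n)⁻¹ k * qPoch q (q * X) k * qPoch q (q ^ k * (q * Z)) (n - k) /
          qPoch q q k * (p * q ^ (n + 1)) ^ k by
    have hn : q ^ n * (q ^ n)⁻¹ = 1 := mul_inv_cancel₀ (pow_ne_zero n hq)
    linear_combination (-1 : ℝ) ^ (n + 1) * (q ^ (n * (n - 1) / 2) * q ^ n) * h +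
      (-1 : ℝ) ^ n * q ^ (n * (n - 1) / 2) * (1 - q ^ (n + 1)) * (1 - p * q ^ (n + 1)) * q⁻¹ *
        (∑ k ∈ range (n + 1), qPoch q (q ^ n)⁻¹ k * qPoch q (q * X) k *
          qPoch q (q ^ k * (q * Z)) (n - k) / qPoch q q k * (p * q ^ (n + 1)) ^ k) * hn
  rw [mul_sum, mul_sum, ← sum_add_distrib, ← sum_add_distrib]
  refine sum_congr rfl fun k hk => ?_
  obtain ⟨m, rfl⟩ := Nat.exists_eq_add_of_le (Nat.lt_succ_iff.mp (mem_range.mp hk))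
  rw [show k + m + 1 - k = m + 1 by lia, show k + m - k = m by lia,
    qPoch_succ' q (q ^ k * Z), qPoch_succ q (q ^ k * (q * Z)),
    show q * (q ^ k * Z) = q ^ k * (q * Z) by ring, show q ^ (k + 1) * Z = q ^ k * (q * Z) by ring]
  have hd := qPoch_self_ne_zero hq0 hq1 (k + 1)
  rw [qPoch_succ] at hd
  have hd1 := left_ne_zero_of_mul hd
  have hd2 := right_ne_zero_of_mul hd
  have hP : (1 - q ^ (k + m + 1)) * qPoch q (q ^ (k + m))⁻¹ k =
      -q ^ (k + m + 1) * (qPoch q (q ^ (k + m + 1))⁻¹ k * (1 - (q ^ (k + m + 1))⁻¹ * q ^ k)) := by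
    rw [← qPoch_succ, qPoch_succ',
      show q * (q ^ (k + m + 1))⁻¹ = (q ^ (k + m))⁻¹ by rw [pow_succ']; field_simp]
    field_simp
    ring
  rw [qPoch_succ, qPoch_succ q q]
  generalize qPoch q (q * X) k = A, qPoch q (q ^ k * (q * Z)) m = B at *
  have aux : -(q ^ (k + m))⁻¹ * (1 - q ^ (k + m + 1)) * (1 - p * q ^ (k + m + 1)) * q⁻¹ *
      (qPoch q (q ^ (k + m))⁻¹ k * A * B / qPoch q q k * (p * q ^ (k + m + 1)) ^ k) =
      -(q ^ (k + m))⁻¹ * (1 - p * q ^ (k + m + 1)) * q⁻¹ * (A * B / qPoch q q k *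
        (p * q ^ (k + m + 1)) ^ k) * ((1 - q ^ (k + m + 1)) * qPoch q (q ^ (k + m))⁻¹ k) := by
    ring
  rw [aux, hP]
  generalize qPoch q (q ^ (k + m + 1))⁻¹ k = C, qPoch q q k = D at *
  rw [show p * q ^ (k + m + 1 + 1) = p * q ^ (k + m + 1) * q by ring, mul_pow _ q, pow_succ (_ * q),
    mul_pow _ q]
  clear hP aux split e1 hd
  generalize (p * q ^ (k + m + 1)) ^ k = T
  simp only [pow_succ, pow_add]
  have hK := pow_ne_zero k hq
  generalize q ^ k = K at *
  rw [mul_comm q K] at hd2 ⊢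
  field_simp
  ring

/-- The three-term recurrence relation of the quantum q-Krawtchouk polynomials. -/
lemma qKrawReal_recurrence {q : ℝ} (hq0 : 0 < q) (hq1 : q < 1) (p : ℝ) (n : ℕ) (X Z : ℝ) :
    p * (1 - X) * qKrawReal q p n X Z =
      (q ^ (3 * n + 1))⁻¹ *
        (q ^ n * (1 - q ^ n * Z) * qKrawReal q p n X Z + qKrawReal q p (n + 1) X Z) +
      (1 - q ^ n) * (1 - p * q ^ n) * (q ^ (2 * n))⁻¹ *
        (q ^ n * q⁻¹ * (1 - q ^ n * q⁻¹ * Z) * qKrawReal q p (n - 1) X Z +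
          qKrawReal q p n X Z) := by
  have hq := hq0.ne'
  have h0 := qKrawReal_raise hq0 hq1 p n X Z
  have h1 := qKrawReal_expand hq0 hq1 p n X Z
  rw [h0]
  rcases n with _ | n
  · simp only [pow_zero, sub_self, zero_mul, add_zero, mul_zero, zero_add, pow_one, inv_one,
      one_mul] at h1 ⊢
    rw [h1]
    field_simp
  rw [Nat.add_sub_cancel] at h1 ⊢
  have h2 := qKrawReal_raise hq0 hq1 p n X Z
  have e : q ^ (n + 1) * q⁻¹ = q ^ n := by rw [pow_succ, mul_inv_cancel_right₀ hq]
  rw [e, h2, h1]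
  field_simp
  ring

lemma Kq_natCast {q : ℝ} (hq0 : 0 < q) (n₁ n₂ : ℕ) (x₁ x₂ N : ℤ) (θ φ : ℝ) :
    Kq q n₁ n₂ x₁ x₂ θ φ N =
      qKrawReal q (θ ^ 2)⁻¹ n₁ (q ^ (-x₁)) (q ^ (-(x₁ + x₂))) *
        qKrawReal q (φ ^ 2)⁻¹ n₂ (q ^ n₁ * q ^ (-(x₁ + x₂))) (q ^ n₁ * q ^ (-N)) := by
  have e (z : ℤ) : q ^ (-(z - (n₁ : ℤ))) = q ^ n₁ * q ^ (-z) := by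
    rw [neg_sub, sub_eq_add_neg, zpow_add₀ hq0.ne', zpow_natCast]
  simp only [Kq, Nat.cast_nonneg, and_self, if_true, Int.toNat_natCast,
    qKraw_eq_qKrawReal hq0, e]

/-- Second recurrence relation (7-term recurrence in the degree indices,
with the convention that `K` with a negative degree index vanishes). -/
theorem second_recurrence (q : ℝ) (hq0 : 0 < q) (hq1 : q < 1)
    (N : ℕ) (hN : 0 < N) (θ φ : ℝ) (hθ : θ ≠ 0) (hφ : φ ≠ 0)
    (n₁ n₂ : ℕ) (hn : n₁ + n₂ ≤ N - 1) (x₁ x₂ : ℕ) (hx : x₁ + x₂ ≤ N) :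
    q ^ (-(x₁ : ℤ)) * Kq q n₁ n₂ x₁ x₂ θ φ N
    = q ^ (-(2 * (n₁ : ℤ))) *
        (q ^ n₁ * (1 + θ ^ 2 - q ^ (-(n₁ : ℤ) - 1) * (1 + q) * θ ^ 2)
          + q ^ (-(n₂ : ℤ) - 1) * θ ^ 2 *
            (1 + φ ^ 2 + q ^ ((n₁ : ℤ) - N - 1) * φ ^ 2
              - q ^ (-(n₂ : ℤ) - 1) * (1 + q) * φ ^ 2)) * Kq q n₁ n₂ x₁ x₂ θ φ N
      + q ^ (-((n₂ : ℤ) + 2)) * φ ^ 2 * (1 - q ^ n₁) * (1 - q ^ ((n₁ : ℤ) + n₂ - N - 1)) *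
        (1 - θ ^ 2 * q ^ (-(n₁ : ℤ))) * Kq q ((n₁ : ℤ) - 1) n₂ x₁ x₂ θ φ N
      + q ^ (-(2 * ((n₂ : ℤ) + 1))) * φ ^ 2 * (1 - q ^ n₁) * (1 - θ ^ 2 * q ^ (-(n₁ : ℤ))) *
        Kq q ((n₁ : ℤ) - 1) ((n₂ : ℤ) + 1) x₁ x₂ θ φ N
      + q ^ (-(2 * (n₁ : ℤ) + 2)) * θ ^ 2 * (1 - q ^ n₂) * (1 - q ^ ((n₁ : ℤ) + n₂ - N - 1)) *
        (1 - φ ^ 2 * q ^ (-(n₂ : ℤ))) * Kq q n₁ ((n₂ : ℤ) - 1) x₁ x₂ θ φ N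
      - q ^ (-(3 * (n₂ : ℤ) + 2 * n₁ + 2)) * θ ^ 2 * φ ^ 2 *
        Kq q n₁ ((n₂ : ℤ) + 1) x₁ x₂ θ φ N
      - q ^ (-(3 * (n₁ : ℤ) + n₂ + 1)) * θ ^ 2 * Kq q (n₁ + 1) n₂ x₁ x₂ θ φ N
      + θ ^ 2 * (φ ^ 2)⁻¹ * q ^ ((n₂ : ℤ) - 3 * n₁ - 2) * (1 - q ^ n₂) *
        (1 - φ ^ 2 * q ^ (-(n₂ : ℤ))) * Kq q (n₁ + 1) ((n₂ : ℤ) - 1) x₁ x₂ θ φ N := by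
  have hq := hq0.ne'
  have lower₁ : ∀ m : ℕ, (1 - q ^ n₁) * Kq q ((n₁ : ℤ) - 1) m x₁ x₂ θ φ N =
      (1 - q ^ n₁) * (qKrawReal q (θ ^ 2)⁻¹ (n₁ - 1) (q ^ (-(x₁ : ℤ))) (q ^ (-((x₁ : ℤ) + x₂))) *
        qKrawReal q (φ ^ 2)⁻¹ m (q ^ n₁ * q⁻¹ * q ^ (-((x₁ : ℤ) + x₂)))
          (q ^ n₁ * q⁻¹ * q ^ (-(N : ℤ)))) := by
    intro m
    rcases n₁ with _ | n
    · simp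
    · rw [show ((n + 1 : ℕ) : ℤ) - 1 = n by lia, Kq_natCast hq0, Nat.add_sub_cancel,
        pow_succ, mul_inv_cancel_right₀ hq]
  have lower₂ : ∀ m : ℕ, (1 - q ^ n₂) * Kq q m ((n₂ : ℤ) - 1) x₁ x₂ θ φ N =
      (1 - q ^ n₂) * (qKrawReal q (θ ^ 2)⁻¹ m (q ^ (-(x₁ : ℤ))) (q ^ (-((x₁ : ℤ) + x₂))) *
        qKrawReal q (φ ^ 2)⁻¹ (n₂ - 1) (q ^ m * q ^ (-((x₁ : ℤ) + x₂)))
          (q ^ m * q ^ (-(N : ℤ)))) := by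
    intro m
    rcases n₂ with _ | n
    · simp
    · rw [show ((n + 1 : ℕ) : ℤ) - 1 = n by lia, Kq_natCast hq0, Nat.add_sub_cancel]
  have l1 := lower₁ n₂
  have l2 := lower₁ (n₂ + 1)
  have l3 := lower₂ n₁
  have l4 := lower₂ (n₁ + 1)
  have c1 := Kq_natCast hq0 n₁ n₂ x₁ x₂ N θ φ
  have c2 := Kq_natCast hq0 n₁ (n₂ + 1) x₁ x₂ N θ φ
  have c3 := Kq_natCast hq0 (n₁ + 1) n₂ x₁ x₂ N θ φ
  push_cast at l2 l4 c2 c3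
  set X := q ^ (-(x₁ : ℤ))
  set Y := q ^ (-((x₁ : ℤ) + x₂))
  set W := q ^ (-(N : ℤ)) with hW
  have ha := qKrawReal_recurrence hq0 hq1 (θ ^ 2)⁻¹ n₁ X Y
  have hb := qKrawReal_recurrence hq0 hq1 (φ ^ 2)⁻¹ n₂ (q ^ n₁ * Y) (q ^ n₁ * W)
  have hs := qKrawReal_expand hq0 hq1 (φ ^ 2)⁻¹ n₂ (q ^ n₁ * Y) (q ^ n₁ * W)
  have hr := qKrawReal_raise hq0 hq1 (φ ^ 2)⁻¹ n₂ (q ^ n₁ * q⁻¹ * Y) (q ^ n₁ * q⁻¹ * W)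
  rw [show q * (q ^ n₁ * Y) = q ^ (n₁ + 1) * Y by ring,
    show q * (q ^ n₁ * W) = q ^ (n₁ + 1) * W by ring] at hs
  rw [show q * (q ^ n₁ * q⁻¹ * Y) = q ^ n₁ * Y by field_simp,
    show q * (q ^ n₁ * q⁻¹ * W) = q ^ n₁ * W by field_simp] at hr
  generalize qKrawReal q (θ ^ 2)⁻¹ n₁ X Y = a0, qKrawReal q (θ ^ 2)⁻¹ (n₁ - 1) X Y = am,
    qKrawReal q (θ ^ 2)⁻¹ (n₁ + 1) X Y = ap at *
  have hW' : (q ^ N)⁻¹ = W := by rw [hW, zpow_neg, zpow_natCast]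
  clear_value X Y W
  simp only [sub_eq_add_neg, neg_add, mul_add, mul_one, zpow_add₀ hq, zpow_neg,
    mul_comm (2 : ℤ), mul_comm (3 : ℤ), zpow_mul, zpow_natCast, zpow_ofNat, hW']
  simp only [pow_add, pow_mul', pow_one, pow_succ _ n₁] at ha hb hs hr l4 c3
  have hQ := pow_ne_zero n₁ hq
  have hR := pow_ne_zero n₂ hq
  have ht := pow_ne_zero 2 hθ
  have hf := pow_ne_zero 2 hφ
  clear lower₁ lower₂ hW hW'
  generalize q ^ n₁ = Q, q ^ n₂ = R, θ ^ 2 = t, φ ^ 2 = f at *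
  generalize qKrawReal q f⁻¹ n₂ (Q * Y) (Q * W) = b0,
    qKrawReal q f⁻¹ (n₂ - 1) (Q * Y) (Q * W) = bm,
    qKrawReal q f⁻¹ (n₂ + 1) (Q * Y) (Q * W) = bp,
    qKrawReal q f⁻¹ n₂ (Q * q * Y) (Q * q * W) = u0,
    qKrawReal q f⁻¹ (n₂ - 1) (Q * q * Y) (Q * q * W) = um,
    qKrawReal q f⁻¹ n₂ (Q * q⁻¹ * Y) (Q * q⁻¹ * W) = d0,
    qKrawReal q f⁻¹ (n₂ + 1) (Q * q⁻¹ * Y) (Q * q⁻¹ * W) = dp at *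
  linear_combination (norm := (field_simp; ring_nf))
    (X - (Q ^ 2)⁻¹ * (Q * (1 + t - Q⁻¹ * q⁻¹ * (1 + q) * t) + R⁻¹ * q⁻¹ * t *
        (1 + f + Q * W * q⁻¹ * f - R⁻¹ * q⁻¹ * (1 + q) * f))) * c1
    - R⁻¹ * (q ^ 2)⁻¹ * f * (1 - Q * R * W * q⁻¹) * (1 - t * Q⁻¹) * l1
    - (R ^ 2 * q ^ 2)⁻¹ * f * (1 - t * Q⁻¹) * l2
    - (Q ^ 2 * q ^ 2)⁻¹ * t * (1 - Q * R * W * q⁻¹) * (1 - f * R⁻¹) * l3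
    + (R ^ 3 * Q ^ 2 * q ^ 2)⁻¹ * t * f * c2
    + (Q ^ 3 * R * q)⁻¹ * t * c3
    - t * f⁻¹ * R * (Q ^ 3 * q ^ 2)⁻¹ * (1 - f * R⁻¹) * l4
    - t * b0 * ha
    - t * f * q⁻¹ * (Q ^ 2)⁻¹ * a0 * hb
    - t * q⁻¹ * (Q ^ 3)⁻¹ * ap * hs
    - f * (R ^ 2 * q ^ 2)⁻¹ * (1 - Q) * (1 - t * Q⁻¹) * am * hr
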